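/- Let n ≥ 3 and let nK be the inverse limit continuum determined by the bonding map φ = nφ described in the context. Then nK is indecomposable. -/

import Mathlib

/-! ## Simple-n-ods in the plane, likeness, arcs, triods, indecomposability -/

/-- The simple-`n`-od `T_n ⊆ ℂ`: the union of `n` unit segments emanating from `0`. -/
def simpleOdSet (n : ℕ) : Set ℂ :=
  {z | ∃ t : ℝ, ∃ k : ℕ, t ∈ Set.Icc (0:ℝ) 1 ∧ k < n ∧
    z = (t : ℂ) * Complex.exp (2 * Real.pi * Complex.I * (k : ℂ) / (n : ℂ))}

/-- `X` is `Y`-like: for every `ε > 0` there is a continuous surjection `X → Y`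
all of whose point-inverses have diameter `< ε`. -/
def IsLike (X Y : Type*) [MetricSpace X] [MetricSpace Y] : Prop :=
  ∀ ε : ℝ, 0 < ε → ∃ g : X → Y, Continuous g ∧ Function.Surjective g ∧
    ∀ y : Y, Metric.diam (g ⁻¹' {y}) < ε

/-- `A` is an arc: it is homeomorphic to `[0,1]`. -/
def IsArcSet {K : Type*} [TopologicalSpace K] (A : Set K) : Prop :=
  Nonempty (↥A ≃ₜ ↥(Set.Icc (0:ℝ) 1))

/-- Two sets are mutually separated: neither meets the closure of the other. -/
def MutuallySeparated {K : Type*} [TopologicalSpace K] (A B : Set K) : Prop :=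
  A ∩ closure B = ∅ ∧ closure A ∩ B = ∅

/-- The (sub)continuum `C` is a triod: it contains a subcontinuum `M` such that
`C \ M` is the union of three nonempty pairwise mutually separated sets. -/
def IsTriodSet {K : Type*} [TopologicalSpace K] (C : Set K) : Prop :=
  ∃ M A B D : Set K, IsCompact M ∧ IsConnected M ∧ M ⊆ C ∧
    A.Nonempty ∧ B.Nonempty ∧ D.Nonempty ∧ C \ M = A ∪ B ∪ D ∧
    MutuallySeparated A B ∧ MutuallySeparated A D ∧ MutuallySeparated B D

/-- A space is atriodic if it contains no subcontinuum which is a triod. -/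
def AtriodicSpace (K : Type*) [TopologicalSpace K] : Prop :=
  ∀ C : Set K, IsCompact C → IsConnected C → ¬ IsTriodSet C

/-- A space is indecomposable if it is not the union of two proper subcontinua. -/
def IndecomposableSpace (K : Type*) [TopologicalSpace K] : Prop :=
  ¬ ∃ A B : Set K, IsCompact A ∧ IsConnected A ∧ IsCompact B ∧ IsConnected B ∧
    A ≠ Set.univ ∧ B ≠ Set.univ ∧ A ∪ B = Set.univ
/-! ## The simple-`n`-od `S`, the bonding map `φ = nφ`, and the continuum `nK` -/

noncomputable section

/-- Arm-coordinate parametrization of the simple-`n`-od in `ℂ`: the pair `(k, t)`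
is sent to the point at (clamped) parameter `t ∈ [0,1]` on the ray in the
direction `e^{2πik/n}`. -/
def embC (n : ℕ) (p : ℕ × ℝ) : ℂ :=
  ((min 1 (max 0 p.2) : ℝ) : ℂ) * Complex.exp (2 * Real.pi * Complex.I * (p.1 : ℂ) / (n : ℂ))

/-- The underlying simple-`n`-od `S ⊆ ℂ`. -/
def Sset (n : ℕ) : Set ℂ := Set.range (embC n)

/-- The simple-`n`-od `S` as a (compact metric) space. -/
abbrev Sspace (n : ℕ) := ↥(Sset n)

/-- Arm coordinates `(ray index, parameter)` of the vertices `v_0, …, v_{n+2}`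
of the graph `X_0`:  `v_0` is the branch point; for `1 ≤ i ≤ n-2`, `v_i` is the tip
of ray `i - 1`; `v_{n-1}` and `v_{n+1}` are the midpoint and tip of ray `n - 2`;
`v_n` and `v_{n+2}` are the midpoint and tip of ray `n - 1`. -/
def vcoord (n i : ℕ) : ℕ × ℝ :=
  if i = 0 then (0, 0)
  else if i ≤ n - 2 then (i - 1, 1)
  else if i = n - 1 then (n - 2, 1 / 2)
  else if i = n then (n - 1, 1 / 2)
  else if i = n + 1 then (n - 2, 1)
  else (n - 1, 1)

/-- The vertex `v_i` of `X_0` as a point of `S`. -/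
def vpt (n i : ℕ) : Sspace n := ⟨embC n (vcoord n i), Set.mem_range_self _⟩

/-- The branch point `v_0` of `S`. -/
def centerPt (n : ℕ) : Sspace n := vpt n 0

/-- Affine interpolation, in arm coordinates, between two adjacent vertices of
`X_0` (they lie on a common ray; if one of them is the branch point, the ray of
the other one is used). -/
def interpC (w w' : ℕ × ℝ) (s : ℝ) : ℕ × ℝ :=
  (if w.2 = 0 then w'.1 else w.1, (1 - s) * w.2 + s * w'.2)

/-- Arm coordinates of the `φ`-image of the `j`-th vertex of `X_1` (counted from
`v_0` outwards) on the `a`-th arm of `X_1` (`1 ≤ a ≤ n`), following the defining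
table of `φ = nφ`:

* arm `a ≤ n - 3` has vertices `v_0, u_a, u_{(n-3)+a}, …, u_{2(n-1)(n-3)+a}, v_a`;
* arm `n - 2` has vertices `v_0, u_{(2n-1)(n-3)+2(n-1)+1}, v_{n-2}`;
* arm `n - 1` has vertices `v_0, u_{(2n-1)(n-3)+2(n-1)+2}, u_{(2n-1)(n-3)+2(n-1)+3},
  v_{n-1}, v_{n+1}`;
* arm `n` has vertices `v_0, u_{(2n-1)(n-3)+1}, …, u_{(2n-1)(n-3)+2(n-1)}, v_n, v_{n+2}`. -/
def imgCoord (n a j : ℕ) : ℕ × ℝ :=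
  if a = n then
    (if j = 0 then vcoord n 0
     else if j ≤ 2 * n - 2 then
       (if j = 1 then vcoord n (n - 1)
        else if j % 2 = 0 then vcoord n 0
        else if j = 3 then vcoord n (n - 2)
        else vcoord n ((j - 3) / 2))
     else if j = 2 * n - 1 then vcoord n n
     else vcoord n (n + 2))
  else if a = n - 1 then
    (if j = 0 then vcoord n 0
     else if j = 1 then vcoord n (n - 1)
     else if j = 2 then vcoord n 0
     else if j = 3 then vcoord n n
     else vcoord n (n + 2))
  else if a = n - 2 then
    (if j = 0 then vcoord n 0
     else if j = 1 then vcoord n (n - 1)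
     else vcoord n (n + 1))
  else
    (if j = 0 then vcoord n 0
     else if j ≤ 2 * n - 1 then
       (if j = 1 then vcoord n (n - 1)
        else if j = 2 * n - 1 then vcoord n n
        else if (j - 1) % 2 = 1 then vcoord n 0
        else vcoord n ((a + (j - 1) / 2 - 2) % (n - 2) + 1))
     else vcoord n (n + 2))

/-- Locating a parameter `t ∈ [0,1]` on arm `a` of the subdivision `X_1`:
returns the index `j` of the edge of `X_1` containing the point together with the
affine coordinate `s ∈ [0,1]` inside this edge.  The vertices of `X_1` are placed
at: `j/(2n)` (`0 ≤ j ≤ 2n`) on arms `a ≤ n-3`; at `0, 1/2, 1` on arm `n-2`;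
at `0, 1/6, 2/6, 3/6, 1` on arm `n-1` (the vertices `v_{n-1}`, `v_{n+1}` sit at
`1/2` and `1`); and at `j/(4n-2)` (`0 ≤ j ≤ 2n-1`) followed by `1` on arm `n`
(the vertices `v_n`, `v_{n+2}` sit at `1/2` and `1`). -/
def segOf (n a : ℕ) (t : ℝ) : ℕ × ℝ :=
  if a = n then
    (if t ≤ 1 / 2 then
      (min (2 * n - 2) ⌊(4 * (n : ℝ) - 2) * t⌋₊,
        (4 * (n : ℝ) - 2) * t - (min (2 * n - 2) ⌊(4 * (n : ℝ) - 2) * t⌋₊ : ℕ))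
     else (2 * n - 1, 2 * t - 1))
  else if a = n - 1 then
    (if t ≤ 1 / 2 then
      (min 2 ⌊6 * t⌋₊, 6 * t - (min 2 ⌊6 * t⌋₊ : ℕ))
     else (3, 2 * t - 1))
  else if a = n - 2 then
    (min 1 ⌊2 * t⌋₊, 2 * t - (min 1 ⌊2 * t⌋₊ : ℕ))
  else
    (min (2 * n - 1) ⌊2 * (n : ℝ) * t⌋₊,
      2 * (n : ℝ) * t - (min (2 * n - 1) ⌊2 * (n : ℝ) * t⌋₊ : ℕ))

/-- The bonding map `φ` in arm coordinates: a point with arm coordinates `p` lies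
on arm `a = p.1 % n + 1` at parameter `t`; it lies in the `j`-th edge of `X_1`
on this arm with affine coordinate `s`, and is mapped to the corresponding affine
combination of the `φ`-images of the endpoints of this edge. -/
def Gmap (n : ℕ) (p : ℕ × ℝ) : ℕ × ℝ :=
  interpC (imgCoord n (p.1 % n + 1) (segOf n (p.1 % n + 1) (min 1 (max 0 p.2))).1)
    (imgCoord n (p.1 % n + 1) ((segOf n (p.1 % n + 1) (min 1 (max 0 p.2))).1 + 1))
    (segOf n (p.1 % n + 1) (min 1 (max 0 p.2))).2

/-- The piecewise-linear bonding map `f : S → S` induced by `φ`. -/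
def fS (n : ℕ) : Sspace n → Sspace n := fun z =>
  ⟨embC n (Gmap n (Function.invFun (embC n) (z : ℂ))), Set.mem_range_self _⟩

/-- The continuum `nK`: the inverse limit of the sequence `S ←f S ←f S ⋯`,
realized inside the countable product `S^ℕ`. -/
abbrev nK (n : ℕ) := {x : ℕ → Sspace n // ∀ k, fS n (x (k + 1)) = x k}

end

lemma norm_embC_dir (n k : ℕ) :
    ‖Complex.exp (2 * Real.pi * Complex.I * (k : ℂ) / (n : ℂ))‖ = 1 := by
  have h : (2 * Real.pi * Complex.I * (k : ℂ) / (n : ℂ)) =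
      ((2 * Real.pi * k / n : ℝ) : ℂ) * Complex.I := by
    push_cast; ring
  rw [h, Complex.norm_exp_ofReal_mul_I]

lemma clamp_eq_self {t : ℝ} (ht : t ∈ Set.Icc (0 : ℝ) 1) : min 1 (max 0 t) = t := by
  rw [max_eq_right ht.1, min_eq_right ht.2]

lemma clamp_nonneg (t : ℝ) : 0 ≤ min 1 (max 0 t) :=
  le_min zero_le_one (le_max_left _ _)

lemma embC_eq {n : ℕ} (hn : 0 < n) {p q : ℕ × ℝ} (h : embC n p = embC n q) :
    min 1 (max 0 p.2) = min 1 (max 0 q.2) ∧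
      (min 1 (max 0 p.2) = 0 ∨ p.1 % n = q.1 % n) := by
  have h1 : min 1 (max 0 p.2) = min 1 (max 0 q.2) := by
    have := congrArg norm h
    simpa only [embC, norm_mul, norm_embC_dir, mul_one, Complex.norm_real, Real.norm_eq_abs,
      abs_of_nonneg (clamp_nonneg _)] using this
  refine ⟨h1, or_iff_not_imp_left.2 fun h0 => ?_⟩
  simp only [embC, ← h1] at h
  have h2 := mul_left_cancel₀ (Complex.ofReal_ne_zero.2 h0) h
  obtain ⟨m, hm⟩ := Complex.exp_eq_exp_iff_exists_int.1 h2
  have hn' : (n : ℂ) ≠ 0 := by exact_mod_cast hn.ne'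
  have h3 : (p.1 : ℂ) = q.1 + m * n := by
    field_simp at hm
    rw [hm]
    ring
  have h4 : (p.1 : ℤ) = q.1 + m * n := by exact_mod_cast h3
  have h5 : (p.1 : ℤ) % n = (q.1 : ℤ) % n := by rw [h4, Int.add_mul_emod_self_right]
  exact_mod_cast h5

lemma embC_mod_eq {n : ℕ} (hn : 0 < n) (k : ℕ) (t : ℝ) : embC n (k % n, t) = embC n (k, t) := by
  have hn' : (n : ℂ) ≠ 0 := by exact_mod_cast hn.ne'
  unfold embC
  congr 1
  refine Complex.exp_eq_exp_iff_exists_int.2 ⟨-((k / n : ℕ) : ℤ), ?_⟩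
  have h : ((k % n : ℕ) : ℂ) = k - (n : ℂ) * (k / n : ℕ) := by
    rw [eq_sub_iff_add_eq]
    exact_mod_cast Nat.mod_add_div k n
  dsimp only
  rw [h, Int.cast_neg, Int.cast_natCast]
  field_simp
  ring

/-- The point of `S` with arm coordinates `(k, t)`. -/
noncomputable def armPt (n k : ℕ) (t : ℝ) : Sspace n := ⟨embC n (k, t), Set.mem_range_self _⟩

lemma continuous_armPt (n k : ℕ) : Continuous (armPt n k) := by
  refine Continuous.subtype_mk ?_ _
  unfold embC
  fun_prop

lemma armPt_zero (n j k : ℕ) : armPt n j 0 = armPt n k 0 := by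
  simp [armPt, embC]

lemma armPt_eq {n : ℕ} {j k : ℕ} (hj : j < n) (hk : k < n) {s t : ℝ}
    (hs : s ∈ Set.Icc (0 : ℝ) 1) (ht : t ∈ Set.Icc (0 : ℝ) 1) (h : armPt n j s = armPt n k t) :
    s = t ∧ (s = 0 ∨ j = k) := by
  have := embC_eq (by omega) (congrArg Subtype.val h)
  simpa only [clamp_eq_self hs, clamp_eq_self ht, Nat.mod_eq_of_lt hj, Nat.mod_eq_of_lt hk]
    using this

lemma exists_armPt {n : ℕ} (hn : 0 < n) (x : Sspace n) :
    ∃ k < n, ∃ t ∈ Set.Icc (0 : ℝ) 1, x = armPt n k t := by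
  obtain ⟨_, ⟨k, t⟩, rfl⟩ := x
  refine ⟨k % n, Nat.mod_lt _ hn, min 1 (max 0 t), ⟨clamp_nonneg t, min_le_left _ _⟩, ?_⟩
  apply Subtype.ext
  change embC n (k, t) = embC n (k % n, _)
  rw [embC_mod_eq hn]
  simp only [embC, clamp_eq_self ⟨clamp_nonneg t, min_le_left _ _⟩]

lemma segOf_zero (n a : ℕ) : segOf n a 0 = (0, 0) := by
  unfold segOf
  split_ifs <;> simp_all

lemma imgCoord_zero (n a : ℕ) : imgCoord n a 0 = (0, 0) := by
  simp [imgCoord, vcoord]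

lemma vcoord_zero (n : ℕ) : vcoord n 0 = (0, 0) := by
  rw [vcoord, if_pos rfl]

lemma vcoord_tip {n i : ℕ} (h0 : 0 < i) (hi : i ≤ n - 2) : vcoord n i = (i - 1, 1) := by
  rw [vcoord, if_neg h0.ne', if_pos hi]

lemma vcoord_sub_one {n : ℕ} (hn : 2 ≤ n) : vcoord n (n - 1) = (n - 2, 1 / 2) := by
  rw [vcoord, if_neg (by omega), if_neg (by omega), if_pos rfl]

lemma vcoord_self {n : ℕ} (hn : 1 ≤ n) : vcoord n n = (n - 1, 1 / 2) := by
  rw [vcoord, if_neg (by omega), if_neg (by omega), if_neg (by omega), if_pos rfl]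

lemma vcoord_add_one {n : ℕ} : vcoord n (n + 1) = (n - 2, 1) := by
  rw [vcoord, if_neg (by omega), if_neg (by omega), if_neg (by omega), if_neg (by omega),
    if_pos rfl]

lemma vcoord_add_two {n : ℕ} : vcoord n (n + 2) = (n - 1, 1) := by
  rw [vcoord, if_neg (by omega), if_neg (by omega), if_neg (by omega), if_neg (by omega),
    if_neg (by omega)]

lemma imgCoord_last_even {n i : ℕ} (h0 : 0 < i) (hi : i ≤ n - 1) :
    imgCoord n n (2 * i) = (0, 0) := by
  rw [imgCoord, if_pos rfl, if_neg (by omega), if_pos (by omega), if_neg (by omega),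
    if_pos (by omega), vcoord_zero]

lemma imgCoord_last_three {n : ℕ} (hn : 3 ≤ n) : imgCoord n n 3 = (n - 3, 1) := by
  rw [imgCoord, if_pos rfl, if_neg (by omega), if_pos (by omega), if_neg (by omega),
    if_neg (by omega), if_pos rfl, vcoord_tip (by omega) le_rfl]
  rfl

lemma imgCoord_last_odd {n i : ℕ} (hi : i < n - 3) :
    imgCoord n n (2 * i + 5) = (i, 1) := by
  rw [imgCoord, if_pos rfl, if_neg (by omega), if_pos (by omega), if_neg (by omega),
    if_neg (by omega), if_neg (by omega), show (2 * i + 5 - 3) / 2 = i + 1 by omega,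
    vcoord_tip (by omega) (by omega)]
  rfl

lemma imgCoord_last_mid {n : ℕ} (hn : 1 ≤ n) : imgCoord n n (2 * n - 1) = (n - 1, 1 / 2) := by
  rw [imgCoord, if_pos rfl, if_neg (by omega), if_neg (by omega), if_pos rfl, vcoord_self hn]

lemma imgCoord_last_tip {n : ℕ} (hn : 1 ≤ n) : imgCoord n n (2 * n) = (n - 1, 1) := by
  rw [imgCoord, if_pos rfl, if_neg (by omega), if_neg (by omega), if_neg (by omega),
    vcoord_add_two]

lemma Gmap_snd_of_clamp_eq_zero (n : ℕ) {p : ℕ × ℝ} (h : min 1 (max 0 p.2) = 0) :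
    (Gmap n p).2 = 0 := by
  simp [Gmap, h, segOf_zero, imgCoord_zero, interpC]

lemma fS_armPt {n : ℕ} (hn : 0 < n) (k : ℕ) (t : ℝ) :
    fS n (armPt n k t) = armPt n (Gmap n (k, t)).1 (Gmap n (k, t)).2 := by
  apply Subtype.ext
  change embC n (Gmap n (Function.invFun (embC n) (embC n (k, t)))) = embC n (Gmap n (k, t))
  have h := Function.invFun_eq (f := embC n) (b := embC n (k, t)) ⟨_, rfl⟩
  set p := Function.invFun (embC n) (embC n (k, t))
  obtain ⟨h1, h2 | h2⟩ := embC_eq hn h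
  · have h3 := Gmap_snd_of_clamp_eq_zero n h2
    have h4 := Gmap_snd_of_clamp_eq_zero n (h1 ▸ h2)
    simp [embC, h3, h4]
  · unfold Gmap
    rw [h1, h2]

/-- The `k`-th closed arm of `S`. -/
def arm (n k : ℕ) : Set (Sspace n) := armPt n k '' Set.Icc 0 1

lemma fS_armPt_eq {n k j l : ℕ} (hk : k < n) {t s r : ℝ} (ht : t ∈ Set.Icc (0 : ℝ) 1)
    (hseg : segOf n (k + 1) t = (j, s))
    (himg : interpC (imgCoord n (k + 1) j) (imgCoord n (k + 1) (j + 1)) s = (l, r)) :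
    fS n (armPt n k t) = armPt n l r := by
  rw [fS_armPt (by omega)]
  have : Gmap n (k, t) = (l, r) := by
    simp only [Gmap, Nat.mod_eq_of_lt hk, clamp_eq_self ht, hseg, himg]
  rw [this]

lemma segOf_last {n j : ℕ} (hn : 3 ≤ n) (hj : j ≤ 2 * n - 2) {s : ℝ} (hs : 0 ≤ s)
    (hs' : s < 1 ∨ j = 2 * n - 2 ∧ s = 1) :
    ((j + s) / (4 * n - 2) : ℝ) ∈ Set.Icc (0 : ℝ) 1 ∧
      segOf n n ((j + s) / (4 * n - 2)) = (j, s) := by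
  have hn' : (3 : ℝ) ≤ n := by exact_mod_cast hn
  have hj' : (j : ℝ) + 2 ≤ 2 * n := by exact_mod_cast (by omega : j + 2 ≤ 2 * n)
  have hs1 : s ≤ 1 := by rcases hs' with h | h <;> linarith
  have hpos : (0 : ℝ) < 4 * n - 2 := by linarith
  have hhalf : ((j + s) / (4 * n - 2) : ℝ) ≤ 1 / 2 := by
    rw [div_le_iff₀ hpos]; linarith
  have hm : (4 * (n : ℝ) - 2) * ((j + s) / (4 * n - 2)) = j + s := by field_simp
  have hfl : min (2 * n - 2) ⌊(j : ℝ) + s⌋₊ = j := by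
    rcases hs' with h | ⟨h, rfl⟩
    · have : ⌊(j : ℝ) + s⌋₊ = j := by
        rw [Nat.floor_eq_iff (by positivity)]
        exact ⟨by linarith, by linarith⟩
      omega
    · have : ⌊(j : ℝ) + 1⌋₊ = j + 1 := by exact_mod_cast Nat.floor_natCast (j + 1)
      omega
  refine ⟨⟨by positivity, by linarith⟩, ?_⟩
  simp only [segOf, if_true, if_pos hhalf, hm, hfl]
  simp

lemma image_last_of_edge {n j l : ℕ} (hn : 3 ≤ n) (hj : j ≤ 2 * n - 2) {c s : ℝ} (hs : 0 ≤ s)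
    (hs' : s < 1 ∨ j = 2 * n - 2 ∧ s = 1) (h0 : imgCoord n n j = (0, 0))
    (h1 : imgCoord n n (j + 1) = (l, c)) :
    armPt n l (s * c) ∈ fS n '' arm n (n - 1) := by
  obtain ⟨hI, hseg⟩ := segOf_last hn hj hs hs'
  refine ⟨_, ⟨_, hI, rfl⟩, ?_⟩
  have hn1 : n - 1 + 1 = n := by omega
  rw [← congrArg (segOf n · _) hn1] at hseg
  refine fS_armPt_eq (by omega) hI hseg ?_
  rw [hn1, h0, h1]
  simp [interpC]

lemma image_last_of_vertex {n j l : ℕ} (hn : 3 ≤ n) (hj : j ≤ 2 * n - 2) {c : ℝ} (hc : c ≠ 0)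
    (h : imgCoord n n j = (l, c)) : armPt n l c ∈ fS n '' arm n (n - 1) := by
  obtain ⟨hI, hseg⟩ := segOf_last hn hj le_rfl (Or.inl zero_lt_one)
  refine ⟨_, ⟨_, hI, rfl⟩, ?_⟩
  have hn1 : n - 1 + 1 = n := by omega
  rw [← congrArg (segOf n · _) hn1] at hseg
  refine fS_armPt_eq (by omega) hI hseg ?_
  rw [hn1, h]
  simp [interpC, hc]

lemma arm_last_subset_image_arm_last {n : ℕ} (hn : 3 ≤ n) :
    arm n (n - 1) ⊆ fS n '' arm n (n - 1) := by
  rintro _ ⟨t, ⟨h0, h1⟩, rfl⟩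
  rcases le_or_gt t (1 / 2) with ht | ht
  · have := image_last_of_edge (l := n - 1) (c := 1 / 2) (s := 2 * t) hn le_rfl (by linarith)
      (by
        rcases ht.lt_or_eq with h | h
        · left; linarith
        · right; exact ⟨rfl, by linarith⟩)
      (by
        rw [show 2 * n - 2 = 2 * (n - 1) by omega]
        exact imgCoord_last_even (by omega) le_rfl)
      (by
        rw [show 2 * n - 2 + 1 = 2 * n - 1 by omega]
        exact imgCoord_last_mid (by omega))
    convert this using 2
    ring
  · have hn1 : n - 1 + 1 = n := by omega
    refine ⟨_, ⟨t, ⟨h0, h1⟩, rfl⟩, ?_⟩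
    refine fS_armPt_eq (j := 2 * n - 1) (s := 2 * t - 1) (by omega) ⟨h0, h1⟩ ?_ ?_
    · simp [hn1, segOf, not_le.2 (by simpa using ht)]
    · rw [hn1, show 2 * n - 1 + 1 = 2 * n by omega, imgCoord_last_mid (by omega),
        imgCoord_last_tip (by omega)]
      norm_num [interpC]
      ring

lemma arm_subset_image_arm_last {n i : ℕ} (hn : 3 ≤ n) (hi : i ≤ n - 3) :
    arm n i ⊆ fS n '' arm n (n - 1) := by
  rintro _ ⟨t, ⟨h0, h1⟩, rfl⟩
  obtain ⟨j, hj, e0, e1⟩ : ∃ j, j + 1 ≤ 2 * n - 2 ∧ imgCoord n n j = (0, 0) ∧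
      imgCoord n n (j + 1) = (i, 1) := by
    rcases hi.lt_or_eq with h | h
    · exact ⟨2 * (i + 2), by omega, imgCoord_last_even (by omega) (by omega),
        imgCoord_last_odd h⟩
    · exact ⟨2 * 1, by omega, imgCoord_last_even (by omega) (by omega),
        h ▸ imgCoord_last_three hn⟩
  rcases h1.lt_or_eq with h | rfl
  · simpa using image_last_of_edge hn (by omega) h0 (Or.inl h) e0 e1
  · exact image_last_of_vertex hn hj one_ne_zero e1

lemma arm_subset_image_arm_straight {n : ℕ} (hn : 3 ≤ n) :
    arm n (n - 2) ⊆ fS n '' arm n (n - 3) := by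
  rintro _ ⟨t, ⟨h0, h1⟩, rfl⟩
  have hn1 : n - 3 + 1 = n - 2 := by omega
  have e0 : imgCoord n (n - 2) 0 = (0, 0) := imgCoord_zero _ _
  have e1 : imgCoord n (n - 2) 1 = (n - 2, 1 / 2) := by
    rw [imgCoord, if_neg (by omega), if_neg (by omega), if_pos rfl, if_neg (by omega), if_pos rfl,
      vcoord_sub_one (by omega)]
  have e2 : imgCoord n (n - 2) 2 = (n - 2, 1) := by
    rw [imgCoord, if_neg (by omega), if_neg (by omega), if_pos rfl, if_neg (by omega), if_neg (by omega),
      vcoord_add_one]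
  have hseg : segOf n (n - 2) t = (min 1 ⌊2 * t⌋₊, 2 * t - (min 1 ⌊2 * t⌋₊ : ℕ)) := by
    simp only [segOf, if_neg (by omega : n - 2 ≠ n), if_neg (by omega : n - 2 ≠ n - 1), if_true]
  refine ⟨_, ⟨t, ⟨h0, h1⟩, rfl⟩, ?_⟩
  rcases lt_or_ge t (1 / 2) with ht | ht
  · have hfl : ⌊2 * t⌋₊ = 0 := Nat.floor_eq_zero.2 (by linarith)
    refine fS_armPt_eq (j := 0) (s := 2 * t) (by omega) ⟨h0, h1⟩ ?_ ?_
    · rw [hn1, hseg, hfl]; simp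
    · rw [hn1, e0, e1]
      norm_num [interpC]
      ring
  · have hfl : 1 ≤ ⌊2 * t⌋₊ := Nat.le_floor (by push_cast; linarith)
    refine fS_armPt_eq (j := 1) (s := 2 * t - 1) (by omega) ⟨h0, h1⟩ ?_ ?_
    · rw [hn1, hseg, min_eq_left hfl]; simp
    · rw [hn1, e1, e2]
      norm_num [interpC]
      ring

lemma arm_last_subset_image_arm {n : ℕ} (hn : 3 ≤ n) :
    arm n (n - 1) ⊆ fS n '' arm n (n - 2) := by
  rintro _ ⟨t, ⟨h0, h1⟩, rfl⟩
  have hn1 : n - 2 + 1 = n - 1 := by omega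
  have e2 : imgCoord n (n - 1) 2 = (0, 0) := by
    rw [imgCoord, if_neg (by omega), if_pos rfl, if_neg (by omega), if_neg (by omega), if_pos rfl,
      vcoord_zero]
  have e3 : imgCoord n (n - 1) 3 = (n - 1, 1 / 2) := by
    rw [imgCoord, if_neg (by omega), if_pos rfl, if_neg (by omega), if_neg (by omega), if_neg (by omega),
      if_pos rfl, vcoord_self (by omega)]
  have e4 : imgCoord n (n - 1) 4 = (n - 1, 1) := by
    rw [imgCoord, if_neg (by omega), if_pos rfl, if_neg (by omega), if_neg (by omega), if_neg (by omega),
      if_neg (by omega), vcoord_add_two]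
  rcases le_or_gt t (1 / 2) with ht | ht
  · have hI : (2 + 2 * t) / 6 ∈ Set.Icc (0 : ℝ) 1 := ⟨by linarith, by linarith⟩
    have hfl : 2 ≤ ⌊2 + 2 * t⌋₊ := Nat.le_floor (by push_cast; linarith)
    have hm : 6 * ((2 + 2 * t) / 6) = 2 + 2 * t := by ring
    refine ⟨_, ⟨_, hI, rfl⟩, fS_armPt_eq (j := 2) (s := 2 * t) (by omega) hI ?_ ?_⟩
    · rw [hn1]
      simp only [segOf, if_neg (by omega : n - 1 ≠ n), if_true,
        if_pos (by linarith : (2 + 2 * t) / 6 ≤ 1 / 2), hm, min_eq_left hfl]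
      simp
    · rw [hn1, e2, e3]
      norm_num [interpC]
      ring
  · refine ⟨_, ⟨t, ⟨h0, h1⟩, rfl⟩,
      fS_armPt_eq (j := 3) (s := 2 * t - 1) (by omega) ⟨h0, h1⟩ ?_ ?_⟩
    · rw [hn1]
      simp only [segOf, if_neg (by omega : n - 1 ≠ n), if_true, if_neg (not_le.2 ht)]
    · rw [hn1, e3, e4]
      norm_num [interpC]
      ring

lemma image_iterate_three_eq_univ {n : ℕ} (hn : 3 ≤ n) {A : Set (Sspace n)}
    (hA : arm n (n - 1) ⊆ A ∨ arm n (n - 2) ⊆ A) : (fS n)^[3] '' A = Set.univ := by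
  have h1 : arm n (n - 1) ⊆ fS n '' A := by
    rcases hA with h | h
    · exact (arm_last_subset_image_arm_last hn).trans (Set.image_mono h)
    · exact (arm_last_subset_image_arm hn).trans (Set.image_mono h)
  have h2 : arm n (n - 1) ⊆ fS n '' (fS n '' A) :=
    (arm_last_subset_image_arm_last hn).trans (Set.image_mono h1)
  have h3 : arm n (n - 3) ⊆ fS n '' (fS n '' A) :=
    (arm_subset_image_arm_last hn le_rfl).trans (Set.image_mono h1)
  have hcomp : (fS n)^[3] '' A = fS n '' (fS n '' (fS n '' A)) := by
    simp only [Set.image_image]; rfl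
  rw [hcomp, Set.eq_univ_iff_forall]
  intro x
  obtain ⟨k, hk, t, ht, rfl⟩ := exists_armPt (by omega) x
  have hx : armPt n k t ∈ arm n k := ⟨t, ht, rfl⟩
  obtain h | h | h : k ≤ n - 3 ∨ k = n - 2 ∨ k = n - 1 := by omega
  · exact Set.image_mono h2 (arm_subset_image_arm_last hn h hx)
  · subst h
    exact Set.image_mono h3 (arm_subset_image_arm_straight hn hx)
  · subst h
    exact Set.image_mono h2 (arm_last_subset_image_arm_last hn hx)

lemma fS_surjective {n : ℕ} (hn : 3 ≤ n) : Function.Surjective (fS n) := by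
  intro x
  have h : x ∈ (fS n)^[3] '' Set.univ := by
    rw [image_iterate_three_eq_univ hn (Or.inl (Set.subset_univ _))]
    trivial
  obtain ⟨y, -, rfl⟩ := h
  exact ⟨_, rfl⟩

/-- A connected subset of `S` containing the tip of an arm and a point of another arm contains
the whole first arm. -/
lemma arm_subset_of_isPreconnected {n j k : ℕ} {C : Set (Sspace n)} (hC : IsPreconnected C)
    (hj : j < n) (hk : k < n) (hjk : j ≠ k) {s : ℝ} (hs : s ∈ Set.Icc (0 : ℝ) 1)
    (htip : armPt n k 1 ∈ C) (hpt : armPt n j s ∈ C) : arm n k ⊆ C := by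
  rintro _ ⟨t, ht, rfl⟩
  let V : Set (Sspace n) := armPt n k '' Set.Icc t 1
  let W : Set (Sspace n) := (⋃ i ∈ {i | i < n ∧ i ≠ k}, arm n i) ∪ armPt n k '' Set.Icc 0 t
  have hV : IsClosed V := (isCompact_Icc.image (continuous_armPt n k)).isClosed
  have hW : IsClosed W := by
    refine IsClosed.union (Set.Finite.isClosed_biUnion ?_ fun i _ => ?_)
      (isCompact_Icc.image (continuous_armPt n k)).isClosed
    · exact (Set.finite_lt_nat n).subset fun i hi => hi.1
    · exact (isCompact_Icc.image (continuous_armPt n i)).isClosed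
  have hcov : C ⊆ V ∪ W := by
    intro x _
    obtain ⟨i, hi, r, hr, rfl⟩ := exists_armPt (by omega) x
    by_cases hik : i = k
    · subst hik
      rcases le_total t r with h | h
      · exact Or.inl ⟨r, ⟨h, hr.2⟩, rfl⟩
      · exact Or.inr (Or.inr ⟨r, ⟨hr.1, h⟩, rfl⟩)
    · exact Or.inr (Or.inl (Set.mem_biUnion (x := i) ⟨hi, hik⟩ ⟨r, hr, rfl⟩))
  obtain ⟨x, hxC, ⟨r, hr, rfl⟩, hxW⟩ := isPreconnected_closed_iff.1 hC V W hV hW hcov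
    ⟨_, htip, 1, ⟨ht.2, le_rfl⟩, rfl⟩
    ⟨_, hpt, Or.inl (Set.mem_biUnion (x := j) ⟨hj, hjk⟩ ⟨s, hs, rfl⟩)⟩
  have hr' : r ∈ Set.Icc (0 : ℝ) 1 := ⟨ht.1.trans hr.1, hr.2⟩
  suffices h : r = t by rwa [← h]
  rcases hxW with hxW | ⟨q, hq, hqr⟩
  · obtain ⟨i, ⟨hi, hik⟩, q, hq, hqr⟩ := Set.mem_iUnion₂.1 hxW
    obtain ⟨h1, h2⟩ := armPt_eq hi hk hq hr' hqr
    have h3 := h2.resolve_right hik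
    linarith [hr.1, ht.1]
  · obtain ⟨h1, -⟩ := armPt_eq hk hk ⟨hq.1, hq.2.trans ht.2⟩ hr' hqr
    linarith [hr.1, hq.2]

lemma image_eq_univ_or_of_union_eq_univ {n : ℕ} (hn : 3 ≤ n) {A B : Set (Sspace n)}
    (hA : IsPreconnected A) (hB : IsPreconnected B) (hAB : A ∪ B = Set.univ) :
    (fS n)^[3] '' A = Set.univ ∨ (fS n)^[3] '' B = Set.univ := by
  wlog htip : armPt n (n - 1) 1 ∈ A generalizing A B
  · have h : armPt n (n - 1) 1 ∈ A ∪ B := hAB ▸ Set.mem_univ _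
    exact (this hB hA (Set.union_comm A B ▸ hAB) (h.resolve_left htip)).symm
  by_cases h : ∃ j < n, j ≠ n - 1 ∧ ∃ s ∈ Set.Icc (0 : ℝ) 1, armPt n j s ∈ A
  · obtain ⟨j, hj, hjn, s, hs, hmem⟩ := h
    exact Or.inl (image_iterate_three_eq_univ hn
      (Or.inl (arm_subset_of_isPreconnected hA hj (by omega) hjn hs htip hmem)))
  · refine Or.inr (image_iterate_three_eq_univ hn (Or.inr ?_))
    rintro _ ⟨t, ht, rfl⟩
    have hmem : armPt n (n - 2) t ∈ A ∪ B := hAB ▸ Set.mem_univ _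
    exact hmem.resolve_left fun hA' => h ⟨n - 2, by omega, by omega, t, ht, hA'⟩

section InverseLimit

variable {X : Type*} {f : X → X}

lemma iterate_apply_of_inverse_sequence {x : ℕ → X} (hx : ∀ k, f (x (k + 1)) = x k) (m k : ℕ) :
    f^[m] (x (k + m)) = x k := by
  induction m with
  | zero => rfl
  | succ m ih => rw [Function.iterate_succ_apply, ← add_assoc, hx, ih]

lemma exists_inverse_sequence_through (hf : Function.Surjective f) (k : ℕ) (y : X) :
    ∃ x : ℕ → X, (∀ i, f (x (i + 1)) = x i) ∧ x k = y := by
  obtain ⟨g, hg⟩ := hf.hasRightInverse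
  refine ⟨fun i => if i < k then f^[k - i] y else g^[i - k] y, fun i => ?_, by simp⟩
  dsimp only
  rcases lt_trichotomy (i + 1) k with h | h | h
  · rw [if_pos h, if_pos (by omega), ← Function.iterate_succ_apply' f]
    congr 1
    omega
  · rw [if_neg (by omega), if_pos (by omega), show i + 1 - k = 0 by omega,
      show k - i = 1 by omega]
    rfl
  · rw [if_neg (by omega), if_neg (by omega), show i + 1 - k = (i - k) + 1 by omega,
      Function.iterate_succ_apply', hg]

variable [TopologicalSpace X]

lemma eq_univ_of_isClosed_of_projections {A : Set {x : ℕ → X // ∀ k, f (x (k + 1)) = x k}}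
    (hA : IsClosed A) (h : ∀ N, ∃ k ≥ N, (fun x => x.1 k) '' A = Set.univ) : A = Set.univ := by
  rw [Set.eq_univ_iff_forall]
  intro x
  have hex : ∀ N, ∃ a ∈ A, ∀ i ≤ N, a.1 i = x.1 i := by
    intro N
    obtain ⟨k, hk, hkA⟩ := h N
    obtain ⟨a, haA, ha⟩ : x.1 k ∈ (fun x => x.1 k) '' A := hkA ▸ Set.mem_univ _
    refine ⟨a, haA, fun i hi => ?_⟩
    obtain ⟨m, rfl⟩ := Nat.exists_eq_add_of_le (hi.trans hk)
    dsimp only at ha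
    rw [← iterate_apply_of_inverse_sequence a.2 m i, ha,
      iterate_apply_of_inverse_sequence x.2 m i]
  choose a haA ha using hex
  refine hA.mem_of_tendsto (b := Filter.atTop) (f := a) ?_ (Filter.Eventually.of_forall haA)
  rw [tendsto_subtype_rng, tendsto_pi_nhds]
  intro i
  exact tendsto_const_nhds.congr'
    (Filter.eventually_atTop.2 ⟨i, fun N hN => (ha N i hN).symm⟩)

/-- If some iterate of a surjective bonding map sends one member of each cover of `X` by two
connected sets onto `X`, then the inverse limit is indecomposable. -/
lemma indecomposableSpace_inverse_limit [T2Space X] (hf : Function.Surjective f) (m : ℕ)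
    (h : ∀ A B : Set X, IsPreconnected A → IsPreconnected B → A ∪ B = Set.univ →
      f^[m] '' A = Set.univ ∨ f^[m] '' B = Set.univ) :
    IndecomposableSpace {x : ℕ → X // ∀ k, f (x (k + 1)) = x k} := by
  rintro ⟨A, B, hAc, hA, hBc, hB, hA', hB', hAB⟩
  have hcont : ∀ k, Continuous fun x : {x : ℕ → X // ∀ k, f (x (k + 1)) = x k} => x.1 k :=
    fun k => (continuous_apply k).comp continuous_subtype_val
  have hproj : ∀ (C : Set {x : ℕ → X // ∀ k, f (x (k + 1)) = x k}) k,
      f^[m] '' ((fun x => x.1 (k + m)) '' C) = (fun x => x.1 k) '' C := by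
    intro C k
    rw [Set.image_image]
    exact Set.image_congr fun x _ => iterate_apply_of_inverse_sequence x.2 m k
  have key : ∀ k, (fun x => x.1 k) '' A = Set.univ ∨ (fun x => x.1 k) '' B = Set.univ := by
    intro k
    rw [← hproj A k, ← hproj B k]
    refine h _ _ (hA.isPreconnected.image _ (hcont _).continuousOn)
      (hB.isPreconnected.image _ (hcont _).continuousOn) ?_
    rw [← Set.image_union, hAB, Set.image_univ, Set.range_eq_univ]
    intro y
    obtain ⟨x, hx, hxy⟩ := exists_inverse_sequence_through hf (k + m) y
    exact ⟨⟨x, hx⟩, hxy⟩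
  by_cases hfreq : ∀ N, ∃ k ≥ N, (fun x => x.1 k) '' A = Set.univ
  · exact hA' (eq_univ_of_isClosed_of_projections hAc.isClosed hfreq)
  · push Not at hfreq
    obtain ⟨N, hN⟩ := hfreq
    refine hB' (eq_univ_of_isClosed_of_projections hBc.isClosed fun M =>
      ⟨max M N, le_max_left _ _, (key _).resolve_left (hN _ (le_max_right _ _))⟩)

end InverseLimit

/-- For `n ≥ 3`, the inverse limit `nK` of the bonding map `φ = nφ`
is indecomposable. -/
theorem statement12 (n : ℕ) (hn : 3 ≤ n) : IndecomposableSpace (nK n) :=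
  indecomposableSpace_inverse_limit (fS_surjective hn) 3
    fun _ _ hA hB hAB => image_eq_univ_or_of_union_eq_univ hn hA hB hAB
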